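/- For every real r > 0, ∑_{n=1}^{∞} 1/(n² + r²) = (1/(2r²))·(πr/tanh(πr) − 1). -/

import Mathlib

open Real

lemma ofReal_mul_I_mem_integerComplement {r : ℝ} (hr : r ≠ 0) :
    (r : ℂ) * Complex.I ∈ Complex.integerComplement := by
  rintro ⟨n, hn⟩
  exact hr (by simpa using (congrArg Complex.im hn).symm)

lemma pi_mul_cot_pi_mul_ofReal_mul_I (r : ℝ) :
    (π : ℂ) * Complex.cot (π * (r * Complex.I)) =
      -Complex.I * ((π / Real.tanh (π * r) : ℝ) : ℂ) := by
  rw [← mul_assoc, Complex.cot, Complex.cos_mul_I, Complex.sin_mul_I, Real.tanh_eq_sinh_div_cosh]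
  push_cast
  rw [div_div_eq_mul_div, div_mul_eq_div_div_swap, Complex.div_I]
  ring

theorem stmt_1 (r : ℝ) (hr : 0 < r) :
    ∑' n : ℕ, 1 / (((n : ℝ) + 1) ^ 2 + r ^ 2)
      = 1 / (2 * r ^ 2) * (Real.pi * r / Real.tanh (Real.pi * r) - 1) := by
  have hz := ofReal_mul_I_mem_integerComplement hr.ne'
  have hterm (n : ℕ) : 1 / ((r : ℂ) * Complex.I - (n + 1)) + 1 / ((r : ℂ) * Complex.I + (n + 1)) =
      -(2 * r * Complex.I) * ((1 / (((n : ℝ) + 1) ^ 2 + r ^ 2) : ℝ) : ℂ) := by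
    have hsub : (r : ℂ) * Complex.I - (n + 1) ≠ 0 := fun h =>
      hr.ne' (by simpa using congrArg Complex.im h)
    have hadd : (r : ℂ) * Complex.I + (n + 1) ≠ 0 := fun h =>
      hr.ne' (by simpa using congrArg Complex.im h)
    have hden : ((n : ℂ) + 1) ^ 2 + (r : ℂ) ^ 2 =
        -(((r : ℂ) * Complex.I - (n + 1)) * (r * Complex.I + (n + 1))) := by
      linear_combination (r : ℂ) ^ 2 * Complex.I_sq
    push_cast
    rw [hden]
    field_simp
    ring
  have key := cot_series_rep' hz
  simp only [hterm, pi_mul_cot_pi_mul_ofReal_mul_I] at key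
  rw [tsum_mul_left, ← Complex.ofReal_tsum] at key
  have hreal : π / Real.tanh (π * r) - 1 / r =
      2 * r * ∑' n : ℕ, 1 / (((n : ℝ) + 1) ^ 2 + r ^ 2) := by
    generalize π / Real.tanh (π * r) = c at key ⊢
    generalize ∑' n : ℕ, 1 / (((n : ℝ) + 1) ^ 2 + r ^ 2) = s at key ⊢
    apply Complex.ofReal_injective
    apply mul_left_cancel₀ (neg_ne_zero.mpr Complex.I_ne_zero)
    rw [div_mul_eq_div_div, Complex.div_I] at key
    push_cast
    linear_combination key
  field_simp at hreal ⊢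
  linarith
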